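/- Let $(X,\mathcal{B}_X,\mu,T)$ be a $\mathbb{Z}^2$-MPS, $\vec v=(1,\beta)\in\mathbb{R}^2$ a direction vector and $b\in(0,\infty)$. Let $B\in\mathcal{B}_X$ and $P$ an infinite subset of $\Lambda^{\vec v}(b)$. The following are equivalent: (a) $\overline{\{U_T^{(m,n)}1_B:(m,n)\in P\}}$ is a compact subset of $L^2(X,\mathcal{B}_X,\mu)$; (b) for every infinite subset $S'=\{(m'_i,n'_i)\}_{i=1}^\infty$ of $P$, $h^{S'}_\mu(T,\{B,B^c\})=0$; (c) for every infinite subset $S'=\{(m'_i,n'_i)\}_{i=1}^\infty$ of $P$ with $\{m'_i\}_{i=1}^\infty$ strictly monotone, $h^{S'}_\mu(T,\{B,B^c\})=0$. -/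

import Mathlib

open MeasureTheory Filter Set
open scoped ENNReal Topology

namespace Directional

noncomputable section

attribute [local instance] Classical.propDecidable

variable {X : Type*} [MeasurableSpace X] {G : Type*}

/-- The set of Koopman images `U_T^w 1_B` for `w ∈ Λ`, as elements of `L²(μ)`. -/
def korbit (μ : Measure X) (T : G → X → X) (Λ : Set G) (B : Set X) :
    Set (Lp ℝ 2 μ) :=
  {g | ∃ w ∈ Λ, (g : X → ℝ) =ᵐ[μ] fun x => B.indicator (fun _ => (1 : ℝ)) (T w x)}

/-- A finite measurable partition of `X`. -/
def IsPartition (α : Finset (Set X)) : Prop :=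
  (∀ A ∈ α, MeasurableSet A) ∧ ((α : Set (Set X)).PairwiseDisjoint id) ∧
    ⋃₀ (α : Set (Set X)) = Set.univ

/-- Static entropy `H_μ(α) = -∑ μ(A) log μ(A)`. -/
def partEnt (μ : Measure X) (α : Finset (Set X)) : ℝ :=
  ∑ A ∈ α, Real.negMulLog (μ A).toReal

/-- The join `⋁_{i=1}^k T^{-w_i} α`. -/
def seqJoin (T : G → X → X) (w : ℕ → G) (α : Finset (Set X)) : ℕ → Finset (Set X)
  | 0 => {Set.univ}
  | k + 1 => ((seqJoin T w α k) ×ˢ α).image fun p => p.1 ∩ (T (w k) ⁻¹' p.2)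

/-- Sequence entropy `h^S_μ(T, α)` along the sequence `w` for the partition `α`. -/
def seqEnt (μ : Measure X) (T : G → X → X) (w : ℕ → G) (α : Finset (Set X)) : ℝ :=
  Filter.atTop.limsup fun k : ℕ => partEnt μ (seqJoin T w α k) / (k : ℝ)

/-- Sequence entropy `h^S_μ(T)`, as the supremum over all finite measurable
partitions (valued in `ℝ≥0∞`). -/
def seqEntSup (μ : Measure X) (T : G → X → X) (w : ℕ → G) : ℝ≥0∞ :=
  ⨆ α : {α : Finset (Set X) // IsPartition α}, ENNReal.ofReal (seqEnt μ T w α)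

/-- `w : ℕ → G` is an enumeration of an infinite subset of `Λ`. -/
def EnumIn (w : ℕ → G) (Λ : Set G) : Prop :=
  Function.Injective w ∧ ∀ i, w i ∈ Λ

/-- Conditional entropy `H_μ(α | F)` with respect to a sub-σ-algebra `F`. -/
def condEntAlg (μ : Measure X) (F : MeasurableSpace X) (α : Finset (Set X)) : ℝ :=
  ∑ A ∈ α, ∫ x, Real.negMulLog ((μ[A.indicator (fun _ => (1 : ℝ)) | F]) x) ∂μ

/-- Conditional entropy `H_μ(α | η)` of a partition given another partition. -/
def condEntPart (μ : Measure X) (α η : Finset (Set X)) : ℝ :=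
  -∑ A ∈ α, ∑ D ∈ η,
    (μ (A ∩ D)).toReal * Real.log ((μ (A ∩ D)).toReal / (μ D).toReal)

/-- A `ℤ²`-measure-preserving system: an action of `ℤ²` by homeomorphisms
(continuous maps with continuous inverses `T (-w)`), preserving `μ`. -/
def IsZ2MPS [TopologicalSpace X] (μ : Measure X) (T : ℤ × ℤ → X → X) : Prop :=
  (∀ w, Continuous (T w)) ∧ T 0 = _root_.id ∧ (∀ v w, T (v + w) = T v ∘ T w) ∧
    ∀ w, MeasurePreserving (T w) μ μ

/-- The strip `Λ^{(1,β)}(b) = {(m,n) : βm - b/2 ≤ n ≤ βm + b/2}`. -/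
def Lam (β b : ℝ) : Set (ℤ × ℤ) :=
  {p | β * (p.1 : ℝ) - b / 2 ≤ (p.2 : ℝ) ∧ (p.2 : ℝ) ≤ β * (p.1 : ℝ) + b / 2}

/-- The `(1,β)`-directional Kronecker algebra with width parameter `b`. -/
def dirKron (μ : Measure X) (T : ℤ × ℤ → X → X) (β b : ℝ) : Set (Set X) :=
  {B | MeasurableSet B ∧ IsCompact (closure (korbit μ T (Lam β b) B))}

/-- The directional Kronecker algebra as a σ-algebra (using width `b = 1`,
which is immaterial since `dirKron` is independent of `b`). -/
def dirKronAlg (μ : Measure X) (T : ℤ × ℤ → X → X) (β : ℝ) : MeasurableSpace X :=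
  MeasurableSpace.generateFrom (dirKron μ T β 1)

/-- The classical Kronecker algebra of the `ℤ²`-system. -/
def kron (μ : Measure X) (T : ℤ × ℤ → X → X) : Set (Set X) :=
  {B | MeasurableSet B ∧ IsCompact (closure (korbit μ T Set.univ B))}

/-- `h^{v,*}_μ(α)`: supremum of directional sequence entropies of `α` over all
infinite subsets of the strip (width `1`, immaterial). -/
def hStar (μ : Measure X) (T : ℤ × ℤ → X → X) (β : ℝ) (α : Finset (Set X)) : ℝ :=
  ⨆ w : {w : ℕ → ℤ × ℤ // EnumIn w (Lam β 1)}, seqEnt μ T w.1 α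

/-- The two-element partition `{B, Bᶜ}`. -/
def pairPart (B : Set X) : Finset (Set X) := {B, Bᶜ}

/-- The pulled-back partition `T^{-g} α = {T_g⁻¹ A : A ∈ α}`. -/
def pullPart (T : G → X → X) (g : G) (α : Finset (Set X)) : Finset (Set X) :=
  α.image fun A => T g ⁻¹' A

end

section Auxiliary

attribute [local instance] Classical.propDecidable

/-- The entropy gained by splitting an atom of mass `a + b` into atoms of masses `a` and `b`. -/
noncomputable def splitEnt (a b : ℝ) : ℝ :=
  Real.negMulLog a + Real.negMulLog b - Real.negMulLog (a + b)

lemma splitEnt_comm (a b : ℝ) : splitEnt a b = splitEnt b a := by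
  unfold splitEnt
  rw [add_comm a b, add_comm (Real.negMulLog a)]

lemma log_two_mul_min_le_splitEnt {a b : ℝ} (ha : 0 ≤ a) (hb : 0 ≤ b) :
    Real.log 2 * min a b ≤ splitEnt a b := by
  wlog hab : a ≤ b generalizing a b
  · rw [min_comm, splitEnt_comm]
    exact this hb ha (le_of_not_ge hab)
  rw [min_eq_left hab]
  rcases ha.eq_or_lt with rfl | ha
  · simp [splitEnt]
  have hb' : 0 < b := ha.trans_le hab
  have h₁ : Real.log 2 + Real.log a ≤ Real.log (a + b) := by
    rw [← Real.log_mul two_ne_zero ha.ne']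
    exact Real.log_le_log (by positivity) (by linarith)
  have h₂ : Real.log b ≤ Real.log (a + b) := Real.log_le_log hb' (by linarith)
  have h₃ := mul_le_mul_of_nonneg_left h₁ ha.le
  have h₄ := mul_le_mul_of_nonneg_left h₂ hb
  simp only [splitEnt, Real.negMulLog]
  linarith

lemma splitEnt_nonneg {a b : ℝ} (ha : 0 ≤ a) (hb : 0 ≤ b) : 0 ≤ splitEnt a b :=
  (mul_nonneg (Real.log_nonneg one_le_two) (le_min ha hb)).trans
    (log_two_mul_min_le_splitEnt ha hb)

lemma splitEnt_le {a b δ : ℝ} (ha : 0 ≤ a) (hb : 0 ≤ b) (hδ : 0 < δ) :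
    splitEnt a b ≤ δ * (a + b) + |Real.log δ| * min a b := by
  wlog hab : a ≤ b generalizing a b
  · rw [min_comm, splitEnt_comm, add_comm a]
    exact this hb ha (le_of_not_ge hab)
  rw [min_eq_left hab]
  rcases ha.eq_or_lt with rfl | ha
  · simp only [splitEnt, Real.negMulLog_zero, zero_add, sub_self, mul_zero, add_zero]
    positivity
  have hb' : 0 < b := ha.trans_le hab
  have hs : 0 < a + b := by linarith
  have h₂ : Real.log (a + b) - Real.log b ≤ a / b := by
    rw [← Real.log_div hs.ne' hb'.ne']
    refine (Real.log_le_sub_one_of_pos (by positivity)).trans_eq ?_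
    field_simp
    ring
  have h₃ : Real.log δ + Real.log (a + b) - Real.log a ≤ δ * (a + b) / a - 1 := by
    rw [← Real.log_mul hδ.ne' hs.ne', ← Real.log_div (by positivity) ha.ne']
    exact Real.log_le_sub_one_of_pos (by positivity)
  have h₄ := mul_le_mul_of_nonneg_left h₂ hb
  have h₅ := mul_le_mul_of_nonneg_left h₃ ha.le
  rw [mul_div_cancel₀ _ hb'.ne'] at h₄
  rw [mul_sub a (_ / a), mul_div_cancel₀ _ ha.ne'] at h₅
  have h₆ := mul_le_mul_of_nonneg_right (neg_le_abs (Real.log δ)) ha.le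
  simp only [splitEnt, Real.negMulLog]
  linarith

variable {X G : Type*}

/-- The refinement of `η` by the pulled-back partition `T_g⁻¹ α`. -/
noncomputable def refinePart (T : G → X → X) (α η : Finset (Set X)) (g : G) : Finset (Set X) :=
  (η ×ˢ α).image fun p => p.1 ∩ (T g ⁻¹' p.2)

lemma seqJoin_succ (T : G → X → X) (w : ℕ → G) (α : Finset (Set X)) (k : ℕ) :
    seqJoin T w α (k + 1) = refinePart T α (seqJoin T w α k) (w k) := rfl

lemma mem_refinePart_pairPart {T : G → X → X} {B D : Set X} {η : Finset (Set X)} {g : G} :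
    D ∈ refinePart T (pairPart B) η g ↔
      ∃ E ∈ η, D = E ∩ T g ⁻¹' B ∨ D = E \ T g ⁻¹' B := by
  simp only [refinePart, pairPart, Finset.mem_image, Finset.mem_product, Finset.mem_insert,
    Finset.mem_singleton, Prod.exists]
  constructor
  · rintro ⟨E, C, ⟨hE, rfl | rfl⟩, rfl⟩
    · exact ⟨E, hE, Or.inl rfl⟩
    · exact ⟨E, hE, Or.inr rfl⟩
  · rintro ⟨E, hE, rfl | rfl⟩
    · exact ⟨E, B, ⟨hE, Or.inl rfl⟩, rfl⟩
    · exact ⟨E, Bᶜ, ⟨hE, Or.inr rfl⟩, rfl⟩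

lemma subset_or_subset_compl_of_mem_seqJoin {T : G → X → X} {B : Set X} {w : ℕ → G} {j k : ℕ}
    (hjk : j < k) {D : Set X} (hD : D ∈ seqJoin T w (pairPart B) k) :
    D ⊆ T (w j) ⁻¹' B ∨ D ⊆ (T (w j) ⁻¹' B)ᶜ := by
  induction k generalizing D with
  | zero => omega
  | succ k ih =>
    obtain ⟨E, hE, h⟩ := mem_refinePart_pairPart.1 hD
    rcases Nat.lt_succ_iff_lt_or_eq.1 hjk with hlt | rfl
    · have hDE : D ⊆ E := by
        rcases h with rfl | rfl
        exacts [inter_subset_left, sdiff_subset]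
      exact (ih hlt hE).imp hDE.trans hDE.trans
    · rcases h with rfl | rfl
      exacts [Or.inl inter_subset_right, Or.inr fun x hx => hx.2]

variable [MeasurableSpace X]

/-- The entropy gained by refining the partition `η` by `{A, Aᶜ}`. -/
noncomputable def splitSum (μ : Measure X) (η : Finset (Set X)) (A : Set X) : ℝ :=
  ∑ D ∈ η, splitEnt (μ.real (D ∩ A)) (μ.real (D \ A))

lemma isPartition_univ : IsPartition ({Set.univ} : Finset (Set X)) := by
  simp [IsPartition]

lemma IsPartition.refinePart_pairPart {T : G → X → X} {B : Set X} {η : Finset (Set X)} {g : G}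
    (hη : IsPartition η) (hA : MeasurableSet (T g ⁻¹' B)) :
    IsPartition (refinePart T (pairPart B) η g) := by
  obtain ⟨hm, hd, hu⟩ := hη
  refine ⟨fun D hD => ?_, fun D hD D' hD' hne => ?_, eq_univ_of_forall fun x => ?_⟩
  · obtain ⟨E, hE, rfl | rfl⟩ := mem_refinePart_pairPart.1 hD
    · exact (hm E hE).inter hA
    · exact (hm E hE).diff hA
  · obtain ⟨E, hE, h⟩ := mem_refinePart_pairPart.1 hD
    obtain ⟨E', hE', h'⟩ := mem_refinePart_pairPart.1 hD'
    refine Set.disjoint_left.2 fun x hx hx' => hne ?_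
    simp only [id] at hx hx'
    have hEE : E = E' := by
      by_contra hEE
      exact Set.disjoint_left.1 (hd hE hE' hEE)
        (show x ∈ E by rcases h with rfl | rfl <;> exact hx.1)
        (show x ∈ E' by rcases h' with rfl | rfl <;> exact hx'.1)
    subst hEE
    rcases h with rfl | rfl <;> rcases h' with rfl | rfl
    · rfl
    · exact absurd hx.2 hx'.2
    · exact absurd hx'.2 hx.2
    · rfl
  · obtain ⟨E, hE, hx⟩ := mem_sUnion.1 (hu.symm ▸ mem_univ x : x ∈ ⋃₀ (η : Set (Set X)))
    by_cases hxA : x ∈ T g ⁻¹' B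
    · exact ⟨E ∩ T g ⁻¹' B, mem_refinePart_pairPart.2 ⟨E, hE, Or.inl rfl⟩, hx, hxA⟩
    · exact ⟨E \ T g ⁻¹' B, mem_refinePart_pairPart.2 ⟨E, hE, Or.inr rfl⟩, hx, hxA⟩

lemma IsPartition.sum_measureReal_inter {μ : Measure X} [IsFiniteMeasure μ]
    {η : Finset (Set X)} (hη : IsPartition η) {S : Set X} (hS : MeasurableSet S) :
    ∑ D ∈ η, μ.real (D ∩ S) = μ.real S := by
  obtain ⟨hm, hd, hu⟩ := hη
  rw [← measureReal_biUnion_finset (f := fun D => D ∩ S)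
    (fun D hD D' hD' hne => (hd hD hD' hne).mono inter_subset_left inter_subset_left)
    fun D hD => (hm D hD).inter hS]
  congr 1
  rw [← iUnion₂_inter]
  have : ⋃ D ∈ η, D = Set.univ := by
    rw [← hu, sUnion_eq_biUnion]; rfl
  rw [this, univ_inter]

lemma IsPartition.sum_measureReal {μ : Measure X} [IsProbabilityMeasure μ]
    {η : Finset (Set X)} (hη : IsPartition η) : ∑ D ∈ η, μ.real D = 1 := by
  simpa using hη.sum_measureReal_inter (μ := μ) MeasurableSet.univ

lemma partEnt_refinePart [Nonempty X] {μ : Measure X} [IsFiniteMeasure μ] {T : G → X → X}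
    {B : Set X} {η : Finset (Set X)} {g : G} (hη : IsPartition η)
    (hA : MeasurableSet (T g ⁻¹' B)) :
    partEnt μ (refinePart T (pairPart B) η g) = partEnt μ η + splitSum μ η (T g ⁻¹' B) := by
  have hB : B ≠ Bᶜ := ne_compl_self
  unfold partEnt refinePart
  rw [Finset.sum_image_of_pairwise_eq_zero, Finset.sum_product, splitSum,
    ← Finset.sum_add_distrib]
  · refine Finset.sum_congr rfl fun D _ => ?_
    rw [pairPart, Finset.sum_pair hB]
    have := measureReal_inter_add_sdiff (μ := μ) (s := D) hA
    simp only [splitEnt, preimage_compl, ← sdiff_eq, ← measureReal_def, this]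
    ring
  · rintro ⟨D, C⟩ h ⟨D', C'⟩ h' hne heq
    simp only [Finset.coe_product, mem_prod, Finset.mem_coe] at h h'
    have hempty : D ∩ T g ⁻¹' C = ∅ := by
      by_contra hcon
      obtain ⟨x, hx⟩ := nonempty_iff_ne_empty.2 hcon
      have hx' : x ∈ D' ∩ T g ⁻¹' C' := by
        simp only at heq
        exact heq ▸ hx
      have hDD : D = D' := by
        by_contra hDD
        exact Set.disjoint_left.1 (hη.2.1 h.1 h'.1 hDD) hx.1 hx'.1
      have hCC : C = C' := by
        have h₁ := h.2
        have h₂ := h'.2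
        simp only [pairPart, Finset.mem_insert, Finset.mem_singleton] at h₁ h₂
        have h₃ : T g x ∈ C := hx.2
        have h₄ : T g x ∈ C' := hx'.2
        rcases h₁ with rfl | rfl <;> rcases h₂ with rfl | rfl
        · rfl
        · exact absurd h₃ h₄
        · exact absurd h₄ h₃
        · rfl
      exact hne (by rw [hDD, hCC])
    simp [hempty]

lemma splitSum_nonneg (μ : Measure X) (η : Finset (Set X)) (A : Set X) : 0 ≤ splitSum μ η A :=
  Finset.sum_nonneg fun _ _ => splitEnt_nonneg measureReal_nonneg measureReal_nonneg

lemma splitSum_le {μ : Measure X} [IsProbabilityMeasure μ] {η : Finset (Set X)}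
    (hη : IsPartition η) {A : Set X} (hA : MeasurableSet A) {δ : ℝ} (hδ : 0 < δ) :
    splitSum μ η A ≤ δ + |Real.log δ| *
      ∑ D ∈ η, min (μ.real (D ∩ A)) (μ.real (D \ A)) := by
  calc splitSum μ η A ≤ ∑ D ∈ η, (δ * μ.real D +
        |Real.log δ| * min (μ.real (D ∩ A)) (μ.real (D \ A))) := by
        refine Finset.sum_le_sum fun D _ => ?_
        refine (splitEnt_le measureReal_nonneg measureReal_nonneg hδ).trans_eq ?_
        rw [measureReal_inter_add_sdiff hA]
    _ = _ := by
        rw [Finset.sum_add_distrib, ← Finset.mul_sum, ← Finset.mul_sum, hη.sum_measureReal,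
          mul_one]

lemma splitSum_le_one {μ : Measure X} [IsProbabilityMeasure μ] {η : Finset (Set X)}
    (hη : IsPartition η) {A : Set X} (hA : MeasurableSet A) : splitSum μ η A ≤ 1 := by
  simpa using splitSum_le (μ := μ) hη hA one_pos

lemma splitSum_le_symmDiff {μ : Measure X} [IsProbabilityMeasure μ] {η : Finset (Set X)}
    (hη : IsPartition η) {A C : Set X} (hA : MeasurableSet A) (hC : MeasurableSet C)
    (hηC : ∀ D ∈ η, D ⊆ C ∨ D ⊆ Cᶜ) {δ : ℝ} (hδ : 0 < δ) :
    splitSum μ η A ≤ δ + |Real.log δ| * μ.real (symmDiff A C) := by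
  refine (splitSum_le hη hA hδ).trans ?_
  rw [← hη.sum_measureReal_inter (hA.symmDiff hC)]
  gcongr with D hD
  rcases hηC D hD with h | h
  · exact (min_le_right _ _).trans
      (measureReal_mono fun x hx => ⟨hx.1, Or.inr ⟨h hx.1, hx.2⟩⟩)
  · exact (min_le_left _ _).trans
      (measureReal_mono fun x hx => ⟨hx.1, Or.inl ⟨hx.2, h hx.1⟩⟩)

lemma exists_le_splitSum {μ : Measure X} [IsProbabilityMeasure μ] {η : Finset (Set X)}
    (hη : IsPartition η) {A : ℕ → Set X} (hA : ∀ i, MeasurableSet (A i)) {ε : ℝ}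
    (hsep : ∀ i j, i ≠ j → ε ≤ μ.real (symmDiff (A i) (A j))) (N : ℕ) :
    ∃ i ≥ N, Real.log 2 * (ε / 2) ≤ splitSum μ η (A i) := by
  by_contra! hcon
  have hlog : 0 < Real.log 2 := Real.log_pos one_lt_two
  have hsmall : ∀ i ≥ N, ∑ D ∈ η, min (μ.real (D ∩ A i)) (μ.real (D \ A i)) < ε / 2 := by
    intro i hi
    refine lt_of_mul_lt_mul_left (lt_of_le_of_lt ?_ (hcon i hi)) hlog.le
    rw [Finset.mul_sum]
    exact Finset.sum_le_sum fun D _ =>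
      log_two_mul_min_le_splitEnt measureReal_nonneg measureReal_nonneg
  obtain ⟨i, j, hne, hij⟩ := Finite.exists_ne_map_eq_of_infinite fun (i : ℕ) (D : η) =>
    decide (μ.real (D.1 ∩ A (N + i)) ≤ μ.real (D.1 \ A (N + i)))
  have hlt := add_lt_add (hsmall (N + i) (by omega)) (hsmall (N + j) (by omega))
  rw [add_halves, ← Finset.sum_add_distrib] at hlt
  refine hlt.not_ge ((hsep (N + i) (N + j) (by omega)).trans ?_)
  rw [← hη.sum_measureReal_inter ((hA _).symmDiff (hA _))]
  refine Finset.sum_le_sum fun D hD => ?_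
  have hD' := congrFun hij ⟨D, hD⟩
  simp only [decide_eq_decide] at hD'
  by_cases h : μ.real (D ∩ A (N + i)) ≤ μ.real (D \ A (N + i))
  · rw [min_eq_left h, min_eq_left (hD'.1 h)]
    refine (measureReal_mono ?_).trans (measureReal_union_le _ _)
    rintro x ⟨hx, ⟨h₁, -⟩ | ⟨h₁, -⟩⟩
    · exact Or.inl ⟨hx, h₁⟩
    · exact Or.inr ⟨hx, h₁⟩
  · rw [min_eq_right (le_of_not_ge h), min_eq_right (le_of_not_ge (hD'.not.1 h))]
    refine (measureReal_mono ?_).trans (measureReal_union_le _ _)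
    rintro x ⟨hx, ⟨-, h₁⟩ | ⟨-, h₁⟩⟩
    · exact Or.inr ⟨hx, h₁⟩
    · exact Or.inl ⟨hx, h₁⟩

lemma isPartition_seqJoin {T : G → X → X} {B : Set X} (hA : ∀ g, MeasurableSet (T g ⁻¹' B))
    (w : ℕ → G) (k : ℕ) : IsPartition (seqJoin T w (pairPart B) k) := by
  induction k with
  | zero => exact isPartition_univ
  | succ k ih => exact ih.refinePart_pairPart (hA _)

lemma partEnt_seqJoin {μ : Measure X} [IsProbabilityMeasure μ] {T : G → X → X} {B : Set X}
    (hA : ∀ g, MeasurableSet (T g ⁻¹' B)) (w : ℕ → G) (k : ℕ) :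
    partEnt μ (seqJoin T w (pairPart B) k) =
      ∑ i ∈ Finset.range k, splitSum μ (seqJoin T w (pairPart B) i) (T (w i) ⁻¹' B) := by
  have : Nonempty X := nonempty_of_isProbabilityMeasure μ
  induction k with
  | zero => simp [partEnt, seqJoin]
  | succ k ih =>
    rw [Finset.sum_range_succ, ← ih, seqJoin_succ,
      partEnt_refinePart (isPartition_seqJoin hA w k) (hA _)]

lemma seqEnt_eq_zero_of_net {μ : Measure X} [IsProbabilityMeasure μ] {T : G → X → X} {B : Set X}
    (hA : ∀ g, MeasurableSet (T g ⁻¹' B)) {w : ℕ → G}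
    (hnet : ∀ r > 0, ∃ N, ∀ i, ∃ j < N, μ.real (symmDiff (T (w i) ⁻¹' B) (T (w j) ⁻¹' B)) < r) :
    seqEnt μ T w (pairPart B) = 0 := by
  have hincr : Tendsto (fun i => splitSum μ (seqJoin T w (pairPart B) i) (T (w i) ⁻¹' B))
      atTop (𝓝 0) := by
    refine Metric.tendsto_atTop.2 fun ε hε => ?_
    obtain ⟨N, hN⟩ := hnet (ε / 2 / (|Real.log (ε / 2)| + 1)) (by positivity)
    refine ⟨N, fun i hi => ?_⟩
    obtain ⟨j, hj, hlt⟩ := hN i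
    rw [Real.dist_0_eq_abs, abs_of_nonneg (splitSum_nonneg _ _ _)]
    refine (splitSum_le_symmDiff (isPartition_seqJoin hA w i) (hA _) (hA (w j))
      (fun D hD => subset_or_subset_compl_of_mem_seqJoin (hj.trans_le hi) hD)
      (half_pos hε)).trans_lt ?_
    rw [lt_div_iff₀ (by positivity)] at hlt
    have := measureReal_nonneg (μ := μ) (s := symmDiff (T (w i) ⁻¹' B) (T (w j) ⁻¹' B))
    rcases this.eq_or_lt with h | h
    · rw [← h]; linarith
    · linarith
  refine Tendsto.limsup_eq ?_
  refine hincr.cesaro.congr fun k => ?_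
  rw [partEnt_seqJoin hA, div_eq_inv_mul]

lemma le_seqEnt {μ : Measure X} [IsProbabilityMeasure μ] {T : G → X → X} {B : Set X}
    (hA : ∀ g, MeasurableSet (T g ⁻¹' B)) {w : ℕ → G} {c : ℝ}
    (hc : ∀ k, c ≤ splitSum μ (seqJoin T w (pairPart B) k) (T (w k) ⁻¹' B)) :
    c ≤ seqEnt μ T w (pairPart B) := by
  refine le_limsup_of_frequently_le (Eventually.frequently ?_)
    (isBoundedUnder_of_eventually_le (a := 1) ?_)
  all_goals
    filter_upwards [eventually_gt_atTop 0] with k hk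
    have hk' : (0 : ℝ) < k := by exact_mod_cast hk
    rw [partEnt_seqJoin hA]
  · rw [le_div_iff₀ hk', mul_comm]
    simpa using Finset.card_nsmul_le_sum (Finset.range k) _ c fun i _ => hc i
  · rw [div_le_iff₀ hk', one_mul]
    simpa using Finset.sum_le_card_nsmul (Finset.range k) _ 1 fun i _ =>
      splitSum_le_one (μ := μ) (isPartition_seqJoin hA w i) (hA (w i))

lemma exists_strictMono_le_seqEnt {μ : Measure X} [IsProbabilityMeasure μ] {T : G → X → X}
    {B : Set X} (hA : ∀ g, MeasurableSet (T g ⁻¹' B)) {w : ℕ → G} {ε : ℝ}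
    (hsep : ∀ i j, i ≠ j → ε ≤ μ.real (symmDiff (T (w i) ⁻¹' B) (T (w j) ⁻¹' B))) :
    ∃ φ : ℕ → ℕ, StrictMono φ ∧
      Real.log 2 * (ε / 2) ≤ seqEnt μ T (w ∘ φ) (pairPart B) := by
  choose F hF hF' using fun η : {η : Finset (Set X) // IsPartition η} =>
    exists_le_splitSum (μ := μ) η.2 (fun i => hA (w i)) hsep
  let s : ℕ → ℕ × {η : Finset (Set X) // IsPartition η} := fun k =>
    Nat.rec (0, ⟨{Set.univ}, isPartition_univ⟩) (fun _ p => (F p.2 p.1 + 1,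
      ⟨refinePart T (pairPart B) p.2.1 (w (F p.2 p.1)), p.2.2.refinePart_pairPart (hA _)⟩)) k
  let φ : ℕ → ℕ := fun k => F (s k).2 (s k).1
  have hs : ∀ k, ((s k).2 : Finset (Set X)) = seqJoin T (w ∘ φ) (pairPart B) k := by
    intro k
    induction k with
    | zero => rfl
    | succ k ih => rw [seqJoin_succ, ← ih]; rfl
  refine ⟨φ, strictMono_nat_of_lt_succ fun k => ?_, le_seqEnt hA fun k => ?_⟩
  · exact Nat.lt_of_succ_le (hF (s (k + 1)).2 (s (k + 1)).1)
  · rw [← hs]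
    exact hF' (s k).2 (s k).1

lemma exists_strictMono_or_strictAnti_comp {f : ℕ → ℤ} (hf : ∀ a, (f ⁻¹' {a}).Finite) :
    ∃ φ : ℕ → ℕ, StrictMono φ ∧ (StrictMono (f ∘ φ) ∨ StrictAnti (f ∘ φ)) := by
  obtain ⟨g, hg | hg⟩ := exists_increasing_or_nonincreasing_subseq (· < ·) f
  · exact ⟨g, g.strictMono, Or.inl fun m n h => hg m n h⟩
  obtain ⟨g', hg' | hg'⟩ := exists_increasing_or_nonincreasing_subseq (· > ·) (f ∘ g)
  · exact ⟨g ∘ g', g.strictMono.comp g'.strictMono, Or.inr fun m n h => hg' m n h⟩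
  refine absurd (hf (f (g (g' 0)))) (Set.infinite_of_injective_forall_mem
    (f := fun n => g (g' n)) (g.injective.comp g'.injective) fun n => ?_)
  rcases Nat.eq_zero_or_pos n with rfl | hn
  · rfl
  · exact le_antisymm (not_lt.1 (hg _ _ (g'.strictMono hn))) (not_lt.1 (hg' _ _ hn))

lemma finite_Lam_inter_fst (β b : ℝ) (a : ℤ) : (Lam β b ∩ {p | p.1 = a}).Finite := by
  refine ((finite_singleton a).prod (finite_Icc ⌈β * a - b / 2⌉ ⌊β * a + b / 2⌋)).subset ?_
  rintro ⟨m, n⟩ ⟨⟨h₁, h₂⟩, rfl⟩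
  exact ⟨rfl, Int.ceil_le.2 h₁, Int.le_floor.2 h₂⟩

lemma isCompact_closure_korbit_iff {μ : Measure X} [IsProbabilityMeasure μ] {T : G → X → X}
    {B : Set X} (hA : ∀ g, MeasurableSet (T g ⁻¹' B)) (P : Set G) :
    IsCompact (closure (korbit μ T P B)) ↔ ∀ r > 0, ∃ t ⊆ P, t.Finite ∧
      ∀ g ∈ P, ∃ h ∈ t, μ.real (symmDiff (T g ⁻¹' B) (T h ⁻¹' B)) < r := by
  let F : G → Lp ℝ 2 μ := fun g => indicatorConstLp 2 (hA g) (measure_ne_top μ _) 1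
  have horbit : korbit μ T P B = F '' P := by
    ext f
    constructor
    · rintro ⟨g, hg, h⟩
      exact ⟨g, hg, Lp.ext (indicatorConstLp_coeFn.trans h.symm)⟩
    · rintro ⟨g, hg, rfl⟩
      exact ⟨g, hg, indicatorConstLp_coeFn⟩
  have hdist : ∀ g h, dist (F g) (F h) = √(μ.real (symmDiff (T g ⁻¹' B) (T h ⁻¹' B))) := by
    intro g h
    rw [dist_indicatorConstLp_eq_norm, norm_indicatorConstLp two_ne_zero ENNReal.ofNat_ne_top,
      Real.sqrt_eq_rpow]
    simp
  have hcompact : IsCompact (closure (F '' P)) ↔ TotallyBounded (F '' P) :=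
    ⟨fun h => h.totallyBounded.subset subset_closure, fun h => h.closure.isCompact_of_isClosed
      isClosed_closure⟩
  rw [horbit, hcompact]
  constructor
  · intro h r hr
    obtain ⟨t, ht, htfin, hcov⟩ := Metric.finite_approx_of_totallyBounded h (√r) (by positivity)
    obtain ⟨u, huP, hufin, rfl⟩ := exists_subset_image_finite_and.1 ⟨t, ht, htfin, rfl⟩
    refine ⟨u, huP, hufin, fun g hg => ?_⟩
    obtain ⟨_, ⟨h', hh', rfl⟩, hlt⟩ := mem_iUnion₂.1 (hcov (mem_image_of_mem F hg))
    rw [Metric.mem_ball, hdist] at hlt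
    exact ⟨h', hh', (Real.sqrt_lt_sqrt_iff measureReal_nonneg).1 hlt⟩
  · intro h
    refine Metric.totallyBounded_iff.2 fun r hr => ?_
    obtain ⟨t, -, htfin, hcov⟩ := h (r ^ 2) (by positivity)
    refine ⟨F '' t, htfin.image F, ?_⟩
    rintro _ ⟨g, hg, rfl⟩
    obtain ⟨h', hh', hlt⟩ := hcov g hg
    refine mem_iUnion₂.2 ⟨F h', mem_image_of_mem F hh', ?_⟩
    rw [Metric.mem_ball, hdist]
    exact (Real.sqrt_lt' hr).2 hlt

lemma seqEnt_eq_zero_of_isCompact {μ : Measure X} [IsProbabilityMeasure μ] {T : G → X → X}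
    {B : Set X} (hA : ∀ g, MeasurableSet (T g ⁻¹' B)) {P : Set G}
    (hc : IsCompact (closure (korbit μ T P B))) {w : ℕ → G} (hw : EnumIn w P) :
    seqEnt μ T w (pairPart B) = 0 := by
  have hsub : korbit μ T (range w) B ⊆ korbit μ T P B := by
    rintro f ⟨_, ⟨i, rfl⟩, hf⟩
    exact ⟨w i, hw.2 i, hf⟩
  have hc' := hc.of_isClosed_subset isClosed_closure (closure_mono hsub)
  refine seqEnt_eq_zero_of_net hA fun r hr => ?_
  obtain ⟨t, ht, htfin, hcov⟩ := (isCompact_closure_korbit_iff hA _).1 hc' r hr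
  obtain ⟨N, hN⟩ := (htfin.preimage hw.1.injOn).bddAbove
  refine ⟨N + 1, fun i => ?_⟩
  obtain ⟨g, hg, hlt⟩ := hcov (w i) (mem_range_self i)
  obtain ⟨j, rfl⟩ := ht hg
  exact ⟨j, Nat.lt_succ_of_le (hN hg), hlt⟩

lemma exists_separated_of_not_isCompact {μ : Measure X} [IsProbabilityMeasure μ]
    {T : G → X → X} {B : Set X} (hA : ∀ g, MeasurableSet (T g ⁻¹' B)) {P : Set G}
    (hc : ¬ IsCompact (closure (korbit μ T P B))) :
    ∃ ε > 0, ∃ w : ℕ → G, EnumIn w P ∧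
      ∀ i j, i ≠ j → ε ≤ μ.real (symmDiff (T (w i) ⁻¹' B) (T (w j) ⁻¹' B)) := by
  rw [isCompact_closure_korbit_iff hA] at hc
  push Not at hc
  obtain ⟨ε, hε, hsep⟩ := hc
  obtain ⟨w, hwP, hw⟩ := exists_seq_of_forall_finset_exists (· ∈ P)
    (fun g h => ε ≤ μ.real (symmDiff (T h ⁻¹' B) (T g ⁻¹' B)))
    fun s hs => hsep s hs s.finite_toSet
  have hw' : ∀ i j, i ≠ j → ε ≤ μ.real (symmDiff (T (w i) ⁻¹' B) (T (w j) ⁻¹' B)) := by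
    intro i j hij
    rcases hij.lt_or_gt with h | h
    · rw [symmDiff_comm]
      exact hw i j h
    · exact hw j i h
  refine ⟨ε, hε, w, ⟨fun i j hij => ?_, hwP⟩, hw'⟩
  by_contra hne
  have := hw' i j hne
  rw [hij, symmDiff_self] at this
  simp at this
  linarith

end Auxiliary

/-- for `B` measurable and `P ⊆ Λ^v(b)` infinite, compactness of
the closure of `{U_T^{(m,n)} 1_B : (m,n) ∈ P}` in `L²` is equivalent to the
vanishing of `h^{S'}_μ(T, {B,Bᶜ})` for every infinite `S' ⊆ P`, and also to the
vanishing along those `S'` with strictly monotone first coordinates. -/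
theorem compact_orbit_iff_seqEnt_pair_zero
    {X : Type*} [MetricSpace X] [CompactSpace X] [MeasurableSpace X] [BorelSpace X]
    (μ : Measure X) [IsProbabilityMeasure μ] (T : ℤ × ℤ → X → X)
    (hT : IsZ2MPS μ T) (β b : ℝ) (hb : 0 < b)
    (B : Set X) (hB : MeasurableSet B)
    (P : Set (ℤ × ℤ)) (hP : P ⊆ Lam β b) (hPinf : P.Infinite) :
    (IsCompact (closure (korbit μ T P B)) ↔
      ∀ w : ℕ → ℤ × ℤ, EnumIn w P → seqEnt μ T w (pairPart B) = 0) ∧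
    (IsCompact (closure (korbit μ T P B)) ↔
      ∀ w : ℕ → ℤ × ℤ, EnumIn w P →
        (StrictMono (fun i => (w i).1) ∨ StrictAnti (fun i => (w i).1)) →
        seqEnt μ T w (pairPart B) = 0) := by
  have hA : ∀ g, MeasurableSet (T g ⁻¹' B) := fun g => (hT.1 g).measurable hB
  have hzero : IsCompact (closure (korbit μ T P B)) →
      ∀ w : ℕ → ℤ × ℤ, EnumIn w P → seqEnt μ T w (pairPart B) = 0 :=
    fun hc w hw => seqEnt_eq_zero_of_isCompact hA hc hw
  have hcompact : (∀ w : ℕ → ℤ × ℤ, EnumIn w P →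
      (StrictMono (fun i => (w i).1) ∨ StrictAnti (fun i => (w i).1)) →
      seqEnt μ T w (pairPart B) = 0) → IsCompact (closure (korbit μ T P B)) := by
    intro h
    by_contra hc
    obtain ⟨ε, hε, w, hw, hsep⟩ := exists_separated_of_not_isCompact hA hc
    obtain ⟨φ, hφ, hmono⟩ := exists_strictMono_or_strictAnti_comp (f := fun i => (w i).1)
      fun a => ((finite_Lam_inter_fst β b a).preimage hw.1.injOn).subset
        fun i hi => ⟨hP (hw.2 i), hi⟩
    obtain ⟨ψ, hψ, hle⟩ := exists_strictMono_le_seqEnt hA (w := w ∘ φ) (ε := ε)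
      fun i j hij => hsep _ _ (hφ.injective.ne hij)
    rw [h ((w ∘ φ) ∘ ψ)
      ⟨(hw.1.comp hφ.injective).comp hψ.injective, fun i => hw.2 _⟩
      (hmono.imp (fun hm => hm.comp hψ) fun hm => hm.comp_strictMono hψ)] at hle
    have := mul_pos (Real.log_pos one_lt_two) (half_pos hε)
    linarith
  exact ⟨⟨hzero, fun h => hcompact fun w hw _ => h w hw⟩,
    fun hc w hw _ => hzero hc w hw, hcompact⟩

end Directional
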